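/- arXiv:1903.05220 — 2 statements merged into one kernel-verified Lean document; each statement's English description precedes it below -/
import Mathlib

section
/- (Lower bound for the newsvendor model risk.) Let h, b > 0 and a > 0, and suppose θ* > 0 satisfies h = (b+h) e^{−aθ*}(1 + aθ*). Then for every θ > 0, the newsvendor model risk G(a,θ) := ha − h/θ + (b+h) e^{−aθ}/θ satisfies G(a,θ) ≥ G(a,θ*) = h a² θ*/(1 + aθ*); in particular, if 0 < ā ≤ a then G(a,θ) ≥ h ā² θ*/(1 + aθ*) > 0. -/
open Real

/-- Lower bound for the newsvendor model risk
`G(a,θ) = h a − h/θ + (b+h) e^{−aθ}/θ`.  If `θ* > 0` is a critical point, i.e.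
`h = (b+h) e^{−aθ*}(1 + aθ*)`, then `G(a,θ) ≥ G(a,θ*) = h a² θ*/(1+aθ*)` for every
`θ > 0`; in particular for any `0 < ā ≤ a` one has `G(a,θ) ≥ h ā² θ*/(1+aθ*) > 0`. -/
theorem newsvendor_risk_lower_bound
    (h b a θstar : ℝ) (hh : 0 < h) (hb : 0 < b) (ha : 0 < a) (hθstar : 0 < θstar)
    (hcrit : h = (b + h) * Real.exp (-(a * θstar)) * (1 + a * θstar)) :
    (∀ θ : ℝ, 0 < θ →
        h * a - h / θstar + (b + h) * Real.exp (-(a * θstar)) / θstar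
          ≤ h * a - h / θ + (b + h) * Real.exp (-(a * θ)) / θ) ∧
    (h * a - h / θstar + (b + h) * Real.exp (-(a * θstar)) / θstar
        = h * a ^ 2 * θstar / (1 + a * θstar)) ∧
    (∀ abar : ℝ, 0 < abar → abar ≤ a → ∀ θ : ℝ, 0 < θ →
        h * abar ^ 2 * θstar / (1 + a * θstar)
          ≤ h * a - h / θ + (b + h) * Real.exp (-(a * θ)) / θ) ∧
    (∀ abar : ℝ, 0 < abar → abar ≤ a → 0 < h * abar ^ 2 * θstar / (1 + a * θstar)) := by
  have hd : 0 < 1 + a * θstar := by positivity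
  have hexp : (b + h) * Real.exp (-(a * θstar)) = h / (1 + a * θstar) :=
    (eq_div_iff hd.ne').mpr hcrit.symm
  have value : h * a - h / θstar + (b + h) * Real.exp (-(a * θstar)) / θstar
      = h * a ^ 2 * θstar / (1 + a * θstar) := by
    rw [hexp]
    field_simp
    ring
  have bound : ∀ θ : ℝ, 0 < θ → h * a ^ 2 * θstar / (1 + a * θstar)
      ≤ h * a - h / θ + (b + h) * Real.exp (-(a * θ)) / θ := by
    intro θ hθ
    have tangent : Real.exp (-(a * θstar)) * (1 + a * θstar - a * θ)
        ≤ Real.exp (-(a * θ)) := by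
      have hsplit : Real.exp (-(a * θ))
          = Real.exp (-(a * θstar)) * Real.exp (a * θstar - a * θ) := by
        rw [← Real.exp_add]
        ring_nf
      rw [hsplit]
      gcongr
      linarith [Real.add_one_le_exp (a * θstar - a * θ)]
    calc h * a ^ 2 * θstar / (1 + a * θstar)
        = h * a - h / θ + h / (1 + a * θstar) * (1 + a * θstar - a * θ) / θ := by
          field_simp
          ring
      _ = h * a - h / θ
          + (b + h) * (Real.exp (-(a * θstar)) * (1 + a * θstar - a * θ)) / θ := by
          rw [← hexp, mul_assoc (b + h)]
      _ ≤ h * a - h / θ + (b + h) * Real.exp (-(a * θ)) / θ := by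
          gcongr
  refine ⟨fun θ hθ => value.trans_le (bound θ hθ), value, fun abar h0 h1 θ hθ => ?_,
    fun abar h0 _ => by positivity⟩
  refine le_trans ?_ (bound θ hθ)
  gcongr
end

section
/- (Variational rate for the exponential model with inverse-gamma prior and gamma variational family.) Let θ_0 > 0 and α, β > 0. For n ≥ 2, let q_n be the Gamma density with shape n and rate n/θ_0, q_n(θ) = (n/θ_0)^n θ^{n−1} e^{−nθ/θ_0}/Γ(n) on (0,∞), let π be the inverse-gamma density π(θ) = (β^α/Γ(α)) θ^{−α−1} e^{−β/θ} on (0,∞), and let KL_n(θ) := n ( log(θ_0/θ) + θ/θ_0 − 1 ) be the Kullback–Leibler divergence between the n-fold products of the exponential distributions with rates θ_0 and θ. Then for all n ≥ 3, (1/n) [ KL(q_n‖π) + ∫_0^∞ q_n(θ) KL_n(θ) dθ ] ≤ C_9 (log n)/n, where C_9 := 1/2 + max( 0, 2 + 2β/θ_0 − log √(2π) − log(β^α/Γ(α)) + α log θ_0 ). -/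
open Real MeasureTheory

lemma integrableOn_pow_mul_exp_neg_mul (k : ℕ) {r : ℝ} (hr : 0 < r) :
    IntegrableOn (fun x : ℝ => x ^ k * Real.exp (-(r * x))) (Set.Ioi 0) := by
  have hk : (-1 : ℝ) < k := by linarith [k.cast_nonneg (α := ℝ)]
  simpa using integrableOn_rpow_mul_exp_neg_mul_rpow hk one_pos hr

lemma integral_pow_mul_exp_neg_mul (k : ℕ) {r : ℝ} (hr : 0 < r) :
    ∫ x in Set.Ioi (0 : ℝ), x ^ k * Real.exp (-(r * x)) = k.factorial / r ^ (k + 1) := by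
  have h := Real.integral_rpow_mul_exp_neg_mul_Ioi (a := k + 1) (by positivity) hr
  rw [Real.Gamma_nat_eq_factorial] at h
  simp only [add_sub_cancel_right, Real.rpow_natCast] at h
  rw [h, ← Nat.cast_add_one, Real.rpow_natCast, one_div, inv_pow, div_eq_inv_mul]

/-- The Gamma density with integer shape `n` and rate `r`. -/
noncomputable def erlangDensity (n : ℕ) (r x : ℝ) : ℝ :=
  r ^ n * x ^ (n - 1) * Real.exp (-(r * x)) / Real.Gamma n

lemma erlangDensity_pos {n : ℕ} (hn : 1 ≤ n) {r x : ℝ} (hr : 0 < r) (hx : 0 < x) :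
    0 < erlangDensity n r x := by
  have := Real.Gamma_pos_of_pos (Nat.cast_pos.mpr hn : (0 : ℝ) < n)
  unfold erlangDensity
  positivity

lemma integrableOn_and_integral_erlangDensity {n : ℕ} (hn : 1 ≤ n) {r : ℝ} (hr : 0 < r) :
    IntegrableOn (erlangDensity n r) (Set.Ioi 0) ∧
      ∫ x in Set.Ioi (0 : ℝ), erlangDensity n r x = 1 := by
  obtain ⟨m, rfl⟩ := Nat.exists_eq_add_of_le' hn
  have h : erlangDensity (m + 1) r =
      fun x => r ^ (m + 1) / m.factorial * (x ^ m * Real.exp (-(r * x))) := by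
    ext x
    simp only [erlangDensity, Nat.cast_add, Nat.cast_one, Real.Gamma_nat_eq_factorial,
      Nat.add_sub_cancel]
    ring
  rw [h]
  refine ⟨(integrableOn_pow_mul_exp_neg_mul m hr).const_mul _, ?_⟩
  rw [integral_const_mul, integral_pow_mul_exp_neg_mul m hr]
  have := m.factorial_pos
  field_simp

lemma erlangDensity_mul_self {n : ℕ} (hn : 1 ≤ n) {r : ℝ} (hr : 0 < r) (x : ℝ) :
    erlangDensity n r x * x = n / r * erlangDensity (n + 1) r x := by
  obtain ⟨m, rfl⟩ := Nat.exists_eq_add_of_le' hn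
  have hg := (Real.Gamma_pos_of_pos (by positivity : (0 : ℝ) < ((m + 1 : ℕ) : ℝ))).ne'
  simp only [erlangDensity, Nat.add_sub_cancel]
  rw [Nat.cast_add_one (m + 1), Real.Gamma_add_one (by positivity)]
  field_simp
  ring

lemma erlangDensity_succ_mul_inv {n : ℕ} (hn : 1 ≤ n) {r x : ℝ} (hr : 0 < r) (hx : 0 < x) :
    erlangDensity (n + 1) r x * x⁻¹ = r / n * erlangDensity n r x := by
  have h := erlangDensity_mul_self hn hr x
  have hn' : (0 : ℝ) < n := Nat.cast_pos.mpr hn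
  field_simp at h ⊢
  linarith

lemma integrableOn_and_integral_erlangDensity_mul_self {n : ℕ} (hn : 1 ≤ n) {r : ℝ}
    (hr : 0 < r) :
    IntegrableOn (fun x => erlangDensity n r x * x) (Set.Ioi 0) ∧
      ∫ x in Set.Ioi (0 : ℝ), erlangDensity n r x * x = n / r := by
  obtain ⟨hi, hv⟩ := integrableOn_and_integral_erlangDensity (Nat.le_succ_of_le hn) hr
  simp only [erlangDensity_mul_self hn hr]
  exact ⟨hi.const_mul _, by rw [integral_const_mul, hv, mul_one]⟩

lemma integrableOn_and_integral_erlangDensity_mul_inv {n : ℕ} (hn : 1 ≤ n) {r : ℝ}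
    (hr : 0 < r) :
    IntegrableOn (fun x => erlangDensity (n + 1) r x * x⁻¹) (Set.Ioi 0) ∧
      ∫ x in Set.Ioi (0 : ℝ), erlangDensity (n + 1) r x * x⁻¹ = r / n := by
  obtain ⟨hi, hv⟩ := integrableOn_and_integral_erlangDensity hn hr
  have h : Set.EqOn (fun x => r / n * erlangDensity n r x)
      (fun x => erlangDensity (n + 1) r x * x⁻¹) (Set.Ioi 0) :=
    fun x hx => (erlangDensity_succ_mul_inv hn hr hx).symm
  refine ⟨IntegrableOn.congr_fun (hi.const_mul _) h measurableSet_Ioi, ?_⟩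
  rw [← setIntegral_congr_fun measurableSet_Ioi h, integral_const_mul, hv, mul_one]

lemma integrableOn_erlangDensity_mul_log {n : ℕ} (hn : 1 ≤ n) {r : ℝ} (hr : 0 < r) :
    IntegrableOn (fun x => erlangDensity (n + 1) r x * Real.log x) (Set.Ioi 0) := by
  have hn' : 1 ≤ n + 1 := Nat.le_succ_of_le hn
  refine Integrable.mono' ((integrableOn_and_integral_erlangDensity_mul_self hn' hr).1.add
    (integrableOn_and_integral_erlangDensity_mul_inv hn hr).1) ?_ ?_
  · exact (integrableOn_and_integral_erlangDensity hn' hr).1.aestronglyMeasurable.mul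
      Real.measurable_log.aestronglyMeasurable
  · refine (ae_restrict_iff' measurableSet_Ioi).mpr (ae_of_all _ fun x (hx : 0 < x) => ?_)
    have hq := erlangDensity_pos hn' hr hx
    have hxi := inv_pos.mpr hx
    rw [norm_mul, Real.norm_of_nonneg hq.le, Pi.add_apply, ← mul_add]
    refine mul_le_mul_of_nonneg_left (abs_le.mpr ⟨?_, ?_⟩) hq.le
    · linarith [Real.one_sub_inv_le_log_of_pos hx]
    · linarith [Real.log_le_sub_one_of_pos hx]

lemma integral_erlangDensity_mul_log_le {n : ℕ} (hn : 1 ≤ n) {r : ℝ} (hr : 0 < r) :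
    ∫ x in Set.Ioi (0 : ℝ), erlangDensity (n + 1) r x * Real.log x ≤
      Real.log ((n + 1 : ℕ) / r) := by
  have hn' : 1 ≤ n + 1 := Nat.le_succ_of_le hn
  obtain ⟨hi₀, hv₀⟩ := integrableOn_and_integral_erlangDensity hn' hr
  obtain ⟨hi₁, hv₁⟩ := integrableOn_and_integral_erlangDensity_mul_self hn' hr
  set μ : ℝ := (n + 1 : ℕ) / r with hμ
  have hμ0 : 0 < μ := by positivity
  calc ∫ x in Set.Ioi (0 : ℝ), erlangDensity (n + 1) r x * Real.log x
      ≤ ∫ x in Set.Ioi (0 : ℝ), ((Real.log μ - 1) * erlangDensity (n + 1) r x +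
          μ⁻¹ * (erlangDensity (n + 1) r x * x)) := by
        refine setIntegral_mono_on (integrableOn_erlangDensity_mul_log hn hr)
          ((hi₀.const_mul _).add (hi₁.const_mul _)) measurableSet_Ioi fun x (hx : 0 < x) => ?_
        have hq := erlangDensity_pos hn' hr hx
        have hl := Real.log_le_sub_one_of_pos (div_pos hx hμ0)
        rw [Real.log_div hx.ne' hμ0.ne', div_eq_mul_inv] at hl
        nlinarith [mul_le_mul_of_nonneg_left hl hq.le]
    _ = Real.log μ := by
        rw [integral_add (hi₀.const_mul _) (hi₁.const_mul _), integral_const_mul,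
          integral_const_mul, hv₀, hv₁, inv_mul_cancel₀ hμ0.ne']
        ring

lemma integral_erlangDensity_mul_affine {n : ℕ} (hn : 1 ≤ n) {r : ℝ} (hr : 0 < r)
    (a b c d : ℝ) :
    ∫ x in Set.Ioi (0 : ℝ),
        erlangDensity (n + 1) r x * (a + b * Real.log x + c * x + d * x⁻¹) =
      a + b * (∫ x in Set.Ioi (0 : ℝ), erlangDensity (n + 1) r x * Real.log x) +
        c * ((n + 1 : ℕ) / r) + d * (r / n) := by
  have hn' : 1 ≤ n + 1 := Nat.le_succ_of_le hn
  obtain ⟨hi₀, hv₀⟩ := integrableOn_and_integral_erlangDensity hn' hr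
  obtain ⟨hi₁, hv₁⟩ := integrableOn_and_integral_erlangDensity_mul_self hn' hr
  obtain ⟨hi₂, hv₂⟩ := integrableOn_and_integral_erlangDensity_mul_inv hn hr
  have hl := integrableOn_erlangDensity_mul_log hn hr
  have h : ∀ x, erlangDensity (n + 1) r x * (a + b * Real.log x + c * x + d * x⁻¹) =
      a * erlangDensity (n + 1) r x + b * (erlangDensity (n + 1) r x * Real.log x) +
        c * (erlangDensity (n + 1) r x * x) + d * (erlangDensity (n + 1) r x * x⁻¹) :=
    fun x => by ring
  simp only [h]
  have h₁ : IntegrableOn (fun x => a * erlangDensity (n + 1) r x +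
      b * (erlangDensity (n + 1) r x * Real.log x)) (Set.Ioi 0) :=
    (hi₀.const_mul a).add (hl.const_mul b)
  have h₂ : IntegrableOn (fun x => a * erlangDensity (n + 1) r x +
      b * (erlangDensity (n + 1) r x * Real.log x) +
      c * (erlangDensity (n + 1) r x * x)) (Set.Ioi 0) := h₁.add (hi₁.const_mul c)
  rw [integral_add h₂ (hi₂.const_mul d), integral_add h₁ (hi₁.const_mul c),
    integral_add (hi₀.const_mul a) (hl.const_mul b)]
  simp only [integral_const_mul, hv₀, hv₁, hv₂, mul_one]

lemma log_erlangDensity {n : ℕ} (hn : 1 ≤ n) {r x : ℝ} (hr : 0 < r) (hx : 0 < x) :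
    Real.log (erlangDensity n r x) =
      n * Real.log r + (n - 1) * Real.log x - r * x - Real.log (Real.Gamma n) := by
  have hg := (Real.Gamma_pos_of_pos (Nat.cast_pos.mpr hn : (0 : ℝ) < n)).ne'
  rw [erlangDensity, Real.log_div (by positivity) hg, Real.log_mul (by positivity) (by positivity),
    Real.log_mul (by positivity) (by positivity), Real.log_exp, Real.log_pow, Real.log_pow,
    Nat.cast_sub hn, Nat.cast_one]
  ring

lemma log_invGammaDensity {α β x : ℝ} (hα : 0 < α) (hβ : 0 < β) (hx : 0 < x) :
    Real.log (β ^ α / Real.Gamma α * x ^ (-α - 1) * Real.exp (-β / x)) =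
      Real.log (β ^ α / Real.Gamma α) + (-α - 1) * Real.log x - β / x := by
  have hg := Real.Gamma_pos_of_pos hα
  rw [Real.log_mul (by positivity) (by positivity), Real.log_mul (by positivity) (by positivity),
    Real.log_rpow hx, Real.log_exp]
  ring

lemma le_log_Gamma_nat {n : ℕ} (hn : 1 ≤ n) :
    n * Real.log n - n - Real.log n / 2 + Real.log (Real.sqrt (2 * Real.pi)) ≤
      Real.log (Real.Gamma n) := by
  have hn' : (0 : ℝ) < n := Nat.cast_pos.mpr hn
  have h := Stirling.le_log_factorial_stirling (Nat.one_le_iff_ne_zero.mp hn)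
  rw [← Real.Gamma_nat_eq_factorial, Real.Gamma_add_one hn'.ne',
    Real.log_mul hn'.ne' (Real.Gamma_pos_of_pos hn').ne'] at h
  rw [Real.log_sqrt (by positivity)]
  linarith

/-- Variational rate for the exponential model with an
inverse-gamma prior and the gamma variational family: with `q_n` the Gamma(n, n/θ₀)
density, `π` the inverse-gamma(α,β) density and
`KL_n(θ) = n(log(θ₀/θ) + θ/θ₀ − 1)` the KL divergence between the `n`-fold products
of exponentials with rates `θ₀` and `θ`, one has for all `n ≥ 3`
`(1/n)[KL(q_n‖π) + ∫ q_n KL_n] ≤ C₉ (log n)/n`. -/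
theorem exponential_inverse_gamma_variational_rate
    (θ0 α β : ℝ) (hθ0 : 0 < θ0) (hα : 0 < α) (hβ : 0 < β) :
    ∀ n : ℕ, 3 ≤ n →
      (1 / (n : ℝ)) *
        ((∫ θ in Set.Ioi (0 : ℝ),
            (((n : ℝ) / θ0) ^ (n : ℕ) * θ ^ ((n : ℕ) - 1) *
                Real.exp (-(n : ℝ) * θ / θ0) / Real.Gamma n) *
              Real.log
                ((((n : ℝ) / θ0) ^ (n : ℕ) * θ ^ ((n : ℕ) - 1) *
                    Real.exp (-(n : ℝ) * θ / θ0) / Real.Gamma n) /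
                  (β ^ α / Real.Gamma α * θ ^ (-α - 1) * Real.exp (-β / θ)))) +
          ∫ θ in Set.Ioi (0 : ℝ),
            (((n : ℝ) / θ0) ^ (n : ℕ) * θ ^ ((n : ℕ) - 1) *
                Real.exp (-(n : ℝ) * θ / θ0) / Real.Gamma n) *
              ((n : ℝ) * (Real.log (θ0 / θ) + θ / θ0 - 1)))
      ≤ (1 / 2 + max 0
            (2 + 2 * β / θ0 - Real.log (Real.sqrt (2 * Real.pi)) -
              Real.log (β ^ α / Real.Gamma α) + α * Real.log θ0)) *
          Real.log n / n := by
  intro n hn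
  have hn1 : 1 ≤ n := by omega
  have hn0 : (0 : ℝ) < n := Nat.cast_pos.mpr hn1
  set r : ℝ := n / θ0 with hr_def
  have hr : 0 < r := by positivity
  have hrθ : r * θ0 = n := by rw [hr_def]; field_simp
  obtain ⟨m, hm⟩ := Nat.exists_eq_add_of_le' hn1
  have hm1 : 1 ≤ m := by omega
  have hm0 : (0 : ℝ) < m := Nat.cast_pos.mpr hm1
  have hnm : (n : ℝ) = m + 1 := by rw [hm]; push_cast; ring
  set c := Real.log (β ^ α / Real.Gamma α)
  set L := ∫ x in Set.Ioi (0 : ℝ), erlangDensity n r x * Real.log x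
  have hq : ∀ x : ℝ, r ^ n * x ^ (n - 1) * Real.exp (-(n : ℝ) * x / θ0) / Real.Gamma n =
      erlangDensity n r x := fun x => by
    rw [erlangDensity, hr_def, neg_mul, neg_div, div_mul_eq_mul_div]
  have hprior : ∫ x in Set.Ioi (0 : ℝ), erlangDensity n r x *
        Real.log (erlangDensity n r x /
          (β ^ α / Real.Gamma α * x ^ (-α - 1) * Real.exp (-β / x))) =
      (n * Real.log r - Real.log (Real.Gamma n) - c) + (n + α) * L + -r * (n / r) +
        β * (r / m) := by
    have h := integral_erlangDensity_mul_affine hm1 hr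
      (n * Real.log r - Real.log (Real.Gamma n) - c) (n + α) (-r) β
    rw [← hm] at h
    refine (setIntegral_congr_fun measurableSet_Ioi fun x (hx : 0 < x) => ?_).trans h
    have hg := Real.Gamma_pos_of_pos hα
    rw [Real.log_div (erlangDensity_pos hn1 hr hx).ne' (by positivity),
      log_erlangDensity hn1 hr hx, log_invGammaDensity hα hβ hx]
    ring
  have hmodel : ∫ x in Set.Ioi (0 : ℝ), erlangDensity n r x *
        (n * (Real.log (θ0 / x) + x / θ0 - 1)) =
      (n * Real.log θ0 - n) + -n * L + r * (n / r) + 0 * (r / m) := by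
    have h := integral_erlangDensity_mul_affine hm1 hr (n * Real.log θ0 - n) (-n) r 0
    rw [← hm] at h
    refine (setIntegral_congr_fun measurableSet_Ioi fun x (hx : 0 < x) => ?_).trans h
    rw [Real.log_div hθ0.ne' hx.ne', hr_def]
    ring
  simp only [hq]
  rw [hprior, hmodel]
  have hL : L ≤ Real.log θ0 := by
    have h := integral_erlangDensity_mul_log_le hm1 hr
    rwa [← hm, show (n : ℝ) / r = θ0 by rw [← hrθ]; field_simp] at h
  have hlog_r : Real.log r = Real.log n - Real.log θ0 := Real.log_div hn0.ne' hθ0.ne'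
  have hinv : β * (r / m) ≤ 2 * β / θ0 := by
    have hm1' : (1 : ℝ) ≤ m := Nat.one_le_cast.mpr hm1
    rw [hr_def, hnm, div_div, mul_div_assoc', div_le_div_iff₀ (by positivity) hθ0]
    nlinarith [mul_pos hβ hθ0]
  have hlog_n : 1 ≤ Real.log n := by
    rw [Real.le_log_iff_exp_le hn0]
    have : (3 : ℝ) ≤ n := by exact_mod_cast hn
    linarith [Real.exp_one_lt_d9]
  have hαL := mul_le_mul_of_nonneg_left hL hα.le
  set M := max 0 (2 + 2 * β / θ0 - Real.log (Real.sqrt (2 * Real.pi)) - c + α * Real.log θ0)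
  have hM0 : 0 ≤ M := le_max_left _ _
  have hM : 2 + 2 * β / θ0 - Real.log (Real.sqrt (2 * Real.pi)) - c + α * Real.log θ0 ≤ M :=
    le_max_right _ _
  rw [one_div, ← div_eq_inv_mul]
  refine div_le_div_of_nonneg_right ?_ hn0.le
  rw [hlog_r]
  nlinarith [le_log_Gamma_nat hn1, mul_le_mul_of_nonneg_left hlog_n hM0]
end
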